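/- For every n ≥ 0, the polynomial P_n representing q_n has degree equal to the Fibonacci number F_{n+1}, where F₀ = 0, F₁ = 1 and F_{k+1} = F_k + F_{k-1}. -/

import Mathlib

open Set MeasureTheory Polynomial

noncomputable section

/-- The class `E` of antitone functions `g : [0,1] → [0,1]` with `g 0 = 1` and
positive integral (functions are modelled as total functions `ℝ → ℝ`,
constrained on `[0,1]`). -/
def E : Set (ℝ → ℝ) :=
  {g | AntitoneOn g (Icc 0 1) ∧ MapsTo g (Icc 0 1) (Icc 0 1) ∧ g 0 = 1 ∧
    0 < ∫ x in (0:ℝ)..1, g x}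

/-- The pseudo-inverse `g*` of `g`, given by `g* y = sup {x ∈ [0,1] | g x ≥ y}`. -/
def pseudoInv (g : ℝ → ℝ) : ℝ → ℝ := fun y => sSup {x | x ∈ Icc (0:ℝ) 1 ∧ y ≤ g x}

/-- The stribolic operator `T`, `(T g) x = (∫_x^1 g*) / (∫_0^1 g)`. -/
def T (g : ℝ → ℝ) : ℝ → ℝ := fun x =>
  (∫ t in x..(1:ℝ), pseudoInv g t) / (∫ t in (0:ℝ)..1, g t)

/-- The canonical stribolic iterates: `h 0 = 1` and `h (n+1) = T (h n)`. -/
def h : ℕ → ℝ → ℝ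
  | 0 => fun _ => 1
  | n + 1 => T (h n)

/-- `κ n = ∫_0^1 h n`. -/
def κ (n : ℕ) : ℝ := ∫ t in (0:ℝ)..1, h n t

/-- The compositions `q n = h n ∘ ⋯ ∘ h 1`, with `q 0 = id`. -/
def q : ℕ → ℝ → ℝ
  | 0 => fun x => x
  | n + 1 => h (n + 1) ∘ q n

/-- `q (n-1)`, with the convention that for `n = 0` (i.e. "`q (-1)`") it is the
constant function `1` (the only convention making the `n = 0` cases hold). -/
def qprev : ℕ → ℝ → ℝ
  | 0 => fun _ => 1
  | n + 1 => q n

/-- `Q n x = ∫_0^x (q n)' (t) * q (n-1) (t) dt`. -/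
def Q (n : ℕ) (x : ℝ) : ℝ := ∫ t in (0:ℝ)..x, deriv (q n) t * qprev n t

/-- A continuous strictly antitone function on `[0,1]` exchanging the endpoints. -/
structure IsDecreasingBij (g : ℝ → ℝ) : Prop where
  continuousOn : ContinuousOn g (Icc 0 1)
  strictAntiOn : StrictAntiOn g (Icc 0 1)
  map_zero : g 0 = 1
  map_one : g 1 = 0

namespace IsDecreasingBij

variable {g : ℝ → ℝ}

lemma mapsTo (hg : IsDecreasingBij g) : MapsTo g (Icc 0 1) (Icc 0 1) := fun _ hx =>
  ⟨hg.map_one ▸ hg.strictAntiOn.antitoneOn hx (right_mem_Icc.2 zero_le_one) hx.2,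
    hg.map_zero ▸ hg.strictAntiOn.antitoneOn (left_mem_Icc.2 zero_le_one) hx hx.1⟩

lemma surjOn (hg : IsDecreasingBij g) : SurjOn g (Icc 0 1) (Icc 0 1) := by
  have := intermediate_value_Icc' zero_le_one hg.continuousOn
  rwa [hg.map_zero, hg.map_one] at this

lemma pseudoInv_apply (hg : IsDecreasingBij g) {x : ℝ} (hx : x ∈ Icc (0 : ℝ) 1) :
    pseudoInv g (g x) = x := by
  have : {z | z ∈ Icc (0 : ℝ) 1 ∧ g x ≤ g z} = Icc 0 x := by
    ext z
    constructor
    · rintro ⟨hz, hle⟩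
      exact ⟨hz.1, (hg.strictAntiOn.le_iff_ge hx hz).1 hle⟩
    · rintro ⟨h0, hzx⟩
      have hz : z ∈ Icc (0 : ℝ) 1 := ⟨h0, hzx.trans hx.2⟩
      exact ⟨hz, (hg.strictAntiOn.le_iff_ge hx hz).2 hzx⟩
  rw [pseudoInv, this, csSup_Icc hx.1]

lemma continuousOn_pseudoInv (hg : IsDecreasingBij g) :
    ContinuousOn (pseudoInv g) (Icc 0 1) := by
  have hc : Continuous (hg.mapsTo.restrict g (Icc 0 1) (Icc 0 1)) :=
    hg.continuousOn.mapsToRestrict hg.mapsTo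
  have hs : Function.Surjective (hg.mapsTo.restrict g (Icc 0 1) (Icc 0 1)) :=
    (MapsTo.restrict_surjective_iff hg.mapsTo).2 hg.surjOn
  rw [continuousOn_iff_continuous_domRestrict, (hc.isClosedMap.isQuotientMap hc hs).continuous_iff]
  refine continuous_subtype_val.congr fun x => ?_
  exact (hg.pseudoInv_apply x.2).symm

lemma pseudoInv_pos (hg : IsDecreasingBij g) {y : ℝ} (hy : y ∈ Ico (0 : ℝ) 1) :
    0 < pseudoInv g y := by
  obtain ⟨x, hx, rfl⟩ := hg.surjOn (Ico_subset_Icc_self hy)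
  rw [hg.pseudoInv_apply hx]
  refine hx.1.lt_of_ne ?_
  rintro rfl
  exact hy.2.ne hg.map_zero

lemma intervalIntegrable_pseudoInv (hg : IsDecreasingBij g) {x y : ℝ}
    (hx : x ∈ Icc (0 : ℝ) 1) (hy : y ∈ Icc (0 : ℝ) 1) :
    IntervalIntegrable (pseudoInv g) volume x y :=
  (hg.continuousOn_pseudoInv.mono (uIcc_subset_Icc hx hy)).intervalIntegrable

lemma integral_pos (hg : IsDecreasingBij g) : 0 < ∫ t in (0 : ℝ)..1, g t := by
  refine intervalIntegral.intervalIntegral_pos_of_pos_on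
    (ContinuousOn.intervalIntegrable (by rw [uIcc_of_le zero_le_one]; exact hg.continuousOn))
    (fun x hx => ?_) zero_lt_one
  rw [← hg.map_one]
  exact hg.strictAntiOn (Ioo_subset_Icc_self hx) (right_mem_Icc.2 zero_le_one) hx.2

lemma strictAntiOn_T (hg : IsDecreasingBij g) : StrictAntiOn (T g) (Icc 0 1) := by
  intro x hx y hy hxy
  have h1 : (1 : ℝ) ∈ Icc (0 : ℝ) 1 := right_mem_Icc.2 zero_le_one
  refine div_lt_div_of_pos_right ?_ hg.integral_pos
  rw [← intervalIntegral.integral_add_adjacent_intervals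
    (hg.intervalIntegrable_pseudoInv hx hy) (hg.intervalIntegrable_pseudoInv hy h1)]
  refine lt_add_of_pos_left _ (intervalIntegral.intervalIntegral_pos_of_pos_on
    (hg.intervalIntegrable_pseudoInv hx hy) (fun t ht => ?_) hxy)
  exact hg.pseudoInv_pos ⟨hx.1.trans ht.1.le, ht.2.trans_le hy.2⟩

lemma continuousOn_T (hg : IsDecreasingBij g) : ContinuousOn (T g) (Icc 0 1) := by
  have h1 : IntegrableOn (pseudoInv g) (uIcc 1 0) := by
    rw [uIcc_of_ge zero_le_one]
    exact hg.continuousOn_pseudoInv.integrableOn_Icc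
  have h2 := (intervalIntegral.continuousOn_primitive_interval h1).neg
  rw [uIcc_of_ge zero_le_one] at h2
  refine (h2.div_const (∫ t in (0 : ℝ)..1, g t)).congr fun _ _ => ?_
  rw [T, intervalIntegral.integral_symm]
  rfl

lemma T_one : T g 1 = 0 := by simp [T]

/-- Change of variables along a polynomial parametrisation `(A, B)` of the graph of `g`. -/
lemma integral_pseudoInv_param (hg : IsDecreasingBij g) {A B : ℝ[X]}
    (hA : MapsTo (fun x => A.eval x) (Icc 0 1) (Icc 0 1))
    (hAB : ∀ x ∈ Icc (0 : ℝ) 1, B.eval x = g (A.eval x))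
    {x y : ℝ} (hx : x ∈ Icc (0 : ℝ) 1) (hy : y ∈ Icc (0 : ℝ) 1) :
    ∫ t in B.eval x..B.eval y, pseudoInv g t =
      ∫ s in x..y, A.eval s * (derivative B).eval s := by
  have hsub : uIcc x y ⊆ Icc (0 : ℝ) 1 := uIcc_subset_Icc hx hy
  rw [← intervalIntegral.integral_comp_mul_deriv' (f := fun s => B.eval s)
    (fun s _ => B.hasDerivAt s) (derivative B).continuous.continuousOn
    (hg.continuousOn_pseudoInv.mono ?_)]
  · refine intervalIntegral.integral_congr fun s hs => ?_
    simp only [Function.comp_apply]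
    rw [hAB s (hsub hs), hg.pseudoInv_apply (hA (hsub hs))]
  · rintro _ ⟨s, hs, rfl⟩
    simp only [hAB s (hsub hs)]
    exact hg.mapsTo (hA (hsub hs))

lemma integral_param (hg : IsDecreasingBij g) {A B : ℝ[X]}
    (hA : MapsTo (fun x => A.eval x) (Icc 0 1) (Icc 0 1))
    (hAB : ∀ x ∈ Icc (0 : ℝ) 1, B.eval x = g (A.eval x))
    {x y : ℝ} (hx : x ∈ Icc (0 : ℝ) 1) (hy : y ∈ Icc (0 : ℝ) 1) :
    ∫ t in A.eval x..A.eval y, g t = ∫ s in x..y, B.eval s * (derivative A).eval s := by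
  have hsub : uIcc x y ⊆ Icc (0 : ℝ) 1 := uIcc_subset_Icc hx hy
  rw [← intervalIntegral.integral_comp_mul_deriv' (f := fun s => A.eval s)
    (fun s _ => A.hasDerivAt s) (derivative A).continuous.continuousOn
    (hg.continuousOn.mono ?_)]
  · refine intervalIntegral.integral_congr fun s hs => ?_
    simp only [Function.comp_apply]
    rw [hAB s (hsub hs)]
  · rintro _ ⟨s, hs, rfl⟩
    exact hA (hsub hs)

/-- The pseudo-inverse has the same integral, so `T` preserves the value at `0`. -/
lemma T_zero (hg : IsDecreasingBij g) {A B : ℝ[X]}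
    (hA : MapsTo (fun x => A.eval x) (Icc 0 1) (Icc 0 1))
    (hAB : ∀ x ∈ Icc (0 : ℝ) 1, B.eval x = g (A.eval x))
    {a b : ℝ} (ha : a ∈ Icc (0 : ℝ) 1) (hb : b ∈ Icc (0 : ℝ) 1)
    (hAa : A.eval a = 0) (hAb : A.eval b = 1) : T g 0 = 1 := by
  have hBa : B.eval a = 1 := by rw [hAB a ha, hAa, hg.map_zero]
  have hBb : B.eval b = 0 := by rw [hAB b hb, hAb, hg.map_one]
  have e1 := hg.integral_pseudoInv_param hA hAB hb ha
  have e2 := hg.integral_param hA hAB ha hb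
  have e3 := intervalIntegral.integral_deriv_mul_eq_sub (a := a) (b := b)
    (fun x _ => B.hasDerivAt x) (fun x _ => A.hasDerivAt x)
    ((derivative B).continuous.intervalIntegrable _ _)
    ((derivative A).continuous.intervalIntegrable _ _)
  rw [intervalIntegral.integral_add
    (Continuous.intervalIntegrable (by fun_prop) _ _)
    (Continuous.intervalIntegrable (by fun_prop) _ _)] at e3
  simp only [mul_comm (eval _ (derivative B))] at e3
  rw [hBa, hBb, intervalIntegral.integral_symm a b] at e1
  rw [hAa, hAb] at e2
  rw [hAa, hBb, ← e2] at e3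
  have : ∫ t in (0 : ℝ)..1, pseudoInv g t = ∫ t in (0 : ℝ)..1, g t := by linarith
  rw [T, this, div_self hg.integral_pos.ne']

end IsDecreasingBij

lemma exists_derivative_eq {K : Type*} [Field K] [CharZero K] (p : K[X]) :
    ∃ S : K[X], derivative S = p := by
  induction p using Polynomial.induction_on' with
  | add p q hp hq =>
    obtain ⟨S, rfl⟩ := hp
    obtain ⟨S', rfl⟩ := hq
    exact ⟨S + S', derivative_add⟩
  | monomial n a =>
    refine ⟨monomial (n + 1) (a / (n + 1)), ?_⟩
    have : (n + 1 : K) ≠ 0 := Nat.cast_add_one_ne_zero n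
    rw [derivative_monomial]
    simp [this]

lemma natDegree_of_derivative_eq_mul {K : Type*} [Field K] [CharZero K] {A B S : K[X]}
    (hA : A ≠ 0) (hB : B.natDegree ≠ 0) (hS : derivative S = A * derivative B) :
    S.natDegree = A.natDegree + B.natDegree := by
  have hB' : derivative B ≠ 0 := fun h0 => hB (derivative_eq_zero.1 h0)
  have h0 : S.natDegree ≠ 0 := fun h0 => by
    rw [derivative_of_natDegree_zero h0] at hS
    exact mul_ne_zero hA hB' hS.symm
  have h1 := congrArg natDegree hS
  rw [natDegree_mul hA hB', natDegree_derivative, natDegree_derivative] at h1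
  omega

lemma pseudoInv_h_zero {y : ℝ} (hy : y ≤ 1) : pseudoInv (h 0) y = 1 := by
  have : {x : ℝ | x ∈ Icc (0 : ℝ) 1 ∧ y ≤ h 0 x} = Icc 0 1 := by
    ext x
    simp [h, hy]
  rw [pseudoInv, this, csSup_Icc zero_le_one]

lemma h_one_apply {x : ℝ} (hx : x ≤ 1) : h 1 x = 1 - x := by
  have e : ∫ t in x..1, pseudoInv (h 0) t = ∫ _ in x..1, (1 : ℝ) :=
    intervalIntegral.integral_congr fun t ht => pseudoInv_h_zero (uIcc_of_le hx ▸ ht).2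
  change (∫ t in x..1, pseudoInv (h 0) t) / (∫ t in (0 : ℝ)..1, h 0 t) = 1 - x
  rw [e]
  simp [h]

/-- Joint induction: `h (n + 1)` is a decreasing bijection whose graph is parametrised by
polynomials of Fibonacci degrees representing `q n` and `q (n + 1)`. -/
lemma exists_param (n : ℕ) : IsDecreasingBij (h (n + 1)) ∧ ∃ A B : ℝ[X],
    (∀ x ∈ Icc (0 : ℝ) 1, q n x = A.eval x) ∧
    (∀ x ∈ Icc (0 : ℝ) 1, q (n + 1) x = B.eval x) ∧
    MapsTo (fun x => A.eval x) (Icc 0 1) (Icc 0 1) ∧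
    (∃ a ∈ Icc (0 : ℝ) 1, ∃ b ∈ Icc (0 : ℝ) 1, A.eval a = 0 ∧ A.eval b = 1) ∧
    A.natDegree = Nat.fib (n + 1) ∧ B.natDegree = Nat.fib (n + 2) := by
  induction n with
  | zero =>
    refine ⟨⟨?_, ?_, ?_, ?_⟩, X, 1 - X, ?_, ?_, ?_, ?_, ?_, ?_⟩
    · exact (continuousOn_const.sub continuousOn_id).congr fun x hx => h_one_apply hx.2
    · intro x hx y hy hxy
      simpa [h_one_apply hx.2, h_one_apply hy.2] using hxy
    · simp [h_one_apply]
    · simp [h_one_apply]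
    · simp [q]
    · intro x hx
      simp [q, h_one_apply hx.2]
    · intro x hx
      simpa using hx
    · exact ⟨0, by simp, 1, by simp, by simp, by simp⟩
    · simp
    · rw [← neg_sub, natDegree_neg, ← C_1, natDegree_X_sub_C]
      simp
  | succ n ih =>
    obtain ⟨hg, A, B, hqA, hqB, hA, ⟨a, ha, b, hb, hAa, hAb⟩, hdA, hdB⟩ := ih
    have hAB : ∀ x ∈ Icc (0 : ℝ) 1, B.eval x = h (n + 1) (A.eval x) := fun x hx => by
      rw [← hqB x hx, ← hqA x hx]; rfl
    have hBa : B.eval a = 1 := by rw [hAB a ha, hAa, hg.map_zero]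
    have hBb : B.eval b = 0 := by rw [hAB b hb, hAb, hg.map_one]
    have hA0 : A ≠ 0 := fun h0 => by simp [h0] at hAb
    have hB0 : B.natDegree ≠ 0 := hdB ▸ (Nat.fib_pos.2 (Nat.succ_pos _)).ne'
    obtain ⟨S, hS⟩ := exists_derivative_eq (A * derivative B)
    have hdS := natDegree_of_derivative_eq_mul hA0 hB0 hS
    have hκ := hg.integral_pos
    set k := ∫ t in (0 : ℝ)..1, h (n + 1) t with hk
    refine ⟨⟨hg.continuousOn_T, hg.strictAntiOn_T, hg.T_zero hA hAB ha hb hAa hAb,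
      IsDecreasingBij.T_one⟩, B, C (-k⁻¹) * (S - C (S.eval a)), hqB, fun x hx => ?_,
      fun x hx => ?_, ⟨b, hb, a, ha, hBb, hBa⟩, hdB, ?_⟩
    · have e1 : q (n + 2) x = T (h (n + 1)) (B.eval x) := by
        rw [← hqB x hx]; rfl
      have e2 := hg.integral_pseudoInv_param hA hAB hx ha
      have e3 : ∫ s in x..a, A.eval s * (derivative B).eval s = S.eval a - S.eval x := by
        simp only [← eval_mul, ← hS]
        exact intervalIntegral.integral_eq_sub_of_hasDerivAt (fun s _ => S.hasDerivAt s)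
          ((derivative S).continuous.intervalIntegrable _ _)
      rw [hBa, e3] at e2
      rw [e1, T, e2]
      simp only [eval_mul, eval_sub, eval_C]
      rw [← hk]
      ring
    · simp only [hAB x hx]
      exact hg.mapsTo (hA hx)
    · rw [natDegree_C_mul (neg_ne_zero.2 (inv_ne_zero hκ.ne')), natDegree_sub_C, hdS, hdA, hdB,
        ← Nat.fib_add_two]

/-- For every n ≥ 0, the polynomial representing q n has degree F (n+1). -/
theorem stmt4 : ∀ n : ℕ, ∀ P : Polynomial ℚ,
    (∀ x ∈ Icc (0:ℝ) 1, q n x = aeval x P) → P.natDegree = Nat.fib (n + 1) := by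
  intro n P hP
  obtain ⟨-, A, -, hA, -, -, -, hdA, -⟩ := exists_param n
  have hPA : P.map (algebraMap ℚ ℝ) = A := by
    refine eq_of_infinite_eval_eq _ _ ((Icc_infinite zero_lt_one).mono fun x hx => ?_)
    rw [mem_ofPred_eq, eval_map_algebraMap, ← hP x hx, hA x hx]
  rw [← hdA, ← hPA, natDegree_map]
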